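/- For every vertex x ∈ V and every ε > 0, the quantity Σ_{x'∈L} e_L(x') · max(P_{x'}[τ_{{x}} < ∞] − ε, 0) converges to 0 as L → V, i.e. along every exhaustion of V. -/

import Mathlib

open MeasureTheory Filter

section Setup

variable {V : Type*} [MeasurableSpace V]

/-- Total weight at a vertex: `a_x = Σ_{z∼x} a_{x,z}`. -/
noncomputable def aTot (G : SimpleGraph V) [G.LocallyFinite] (a : V → V → ℝ) (x : V) : ℝ :=
  ∑ z ∈ G.neighborFinset x, a x z

open Classical in
/-- Transition probabilities of the weighted random walk:
`p(x,y) = a_{x,y}/a_x` for edges and `0` otherwise. -/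
noncomputable def step (G : SimpleGraph V) [G.LocallyFinite] (a : V → V → ℝ) (x y : V) : ℝ :=
  if G.Adj x y then a x y / aTot G a x else 0

/-- The event `{τ_K^+ = ∞}`: the walk never returns to `K` at a time `n ≥ 1`. -/
def noReturn (K : Set V) : Set (ℕ → V) := {w | ∀ n ≥ 1, w n ∉ K}

/-- The event `{τ_K < ∞}`: the walk hits `K`. -/
def hits (K : Set V) : Set (ℕ → V) := {w | ∃ n, w n ∈ K}

/-- The event `{τ_K < ∞ and X_{τ_K} = y}`: the walk hits `K`, entering it at `y`. -/
def hitsAt (K : Set V) (y : V) : Set (ℕ → V) :=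
  {w | (∃ n, w n ∈ K) ∧ w (sInf {n | w n ∈ K}) = y}

/-- The event `{λ_K < ∞ and X_{λ_K} = y}`: the walk visits `K`, finitely often,
and its last visit to `K` is at `y`. -/
def lastVisitAt (K : Set V) (y : V) : Set (ℕ → V) :=
  {w | (∃ n, w n ∈ K) ∧ {n | w n ∈ K}.Finite ∧ w (sSup {n | w n ∈ K}) = y}

open Classical in
/-- The equilibrium measure of a finite vertex set `K`:
`e_K(x) = a_x · P_x[τ_K^+ = ∞]` for `x ∈ K`, and `0` otherwise. -/
noncomputable def equil (G : SimpleGraph V) [G.LocallyFinite] (a : V → V → ℝ)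
    (P : V → Measure (ℕ → V)) (K : Finset V) (x : V) : ℝ :=
  if x ∈ K then aTot G a x * ((P x) (noReturn (K : Set V))).toReal else 0

/-- The capacity of a finite vertex set `K`: `cap(K) = Σ_{x∈K} e_K(x)`. -/
noncomputable def capa (G : SimpleGraph V) [G.LocallyFinite] (a : V → V → ℝ)
    (P : V → Measure (ℕ → V)) (K : Finset V) : ℝ :=
  ∑ x ∈ K, equil G a P K x

/-- The harmonic measure of a nonempty finite vertex set `K`: `harm_K = e_K / cap(K)`. -/
noncomputable def harm (G : SimpleGraph V) [G.LocallyFinite] (a : V → V → ℝ)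
    (P : V → Measure (ℕ → V)) (K : Finset V) (x : V) : ℝ :=
  equil G a P K x / capa G a P K

end Setup

section MarkovChain

variable {V : Type*}

/-- The paths that agree with `c` up to time `n`. -/
def cylinderUpTo (n : ℕ) (c : ℕ → V) : Set (ℕ → V) := {w | ∀ i ≤ n, w i = c i}

/-- The path seen from time `n` on. -/
def shiftPath (n : ℕ) (w : ℕ → V) : ℕ → V := fun k => w (n + k)

/-- The first `n + 1` positions of a path. -/
def initialSegment (n : ℕ) (w : ℕ → V) : Fin (n + 1) → V := fun i => w i

theorem preimage_initialSegment_singleton (n : ℕ) (c : ℕ → V) :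
    initialSegment n ⁻¹' {initialSegment n c} = cylinderUpTo n c := by
  ext w
  simp only [Set.mem_preimage, Set.mem_singleton_iff, funext_iff, initialSegment, cylinderUpTo,
    Set.mem_ofPred_eq, Fin.forall_iff, Nat.lt_succ_iff]

theorem initialSegment_surjective (n : ℕ) :
    Function.Surjective (initialSegment n : (ℕ → V) → Fin (n + 1) → V) := by
  intro c
  refine ⟨fun k => c (Fin.ofNat (n + 1) k), funext fun i => ?_⟩
  simp [initialSegment]

theorem hits_eq_iUnion (K : Set V) : hits K = ⋃ n, {w : ℕ → V | w n ∈ K} := by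
  ext w
  simp [hits]

/-- The event that the last visit to `K` takes place in `S`. -/
def lastVisitIn (K S : Set V) : Set (ℕ → V) :=
  {w | ∃ k, w k ∈ K ∧ w k ∈ S ∧ ∀ j > k, w j ∉ K}

theorem isPiSystem_cylinderUpTo :
    IsPiSystem {A : Set (ℕ → V) | ∃ n c, A = cylinderUpTo n c} := by
  have key : ∀ (n m : ℕ) (c d : ℕ → V), n ≤ m →
      (cylinderUpTo n c ∩ cylinderUpTo m d).Nonempty →
      cylinderUpTo n c ∩ cylinderUpTo m d = cylinderUpTo m d := by
    rintro n m c d hnm ⟨w, hwc, hwd⟩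
    refine Set.inter_eq_right.2 fun u hu i hi => ?_
    rw [hu i (hi.trans hnm), ← hwd i (hi.trans hnm), hwc i hi]
  rintro _ ⟨n, c, rfl⟩ _ ⟨m, d, rfl⟩ hne
  rcases le_total n m with h | h
  · exact ⟨m, d, key n m c d h hne⟩
  · rw [Set.inter_comm] at hne ⊢
    exact ⟨n, c, key m n d c h hne⟩

variable [MeasurableSpace V]

theorem measurable_shiftPath (n : ℕ) : Measurable (shiftPath n : (ℕ → V) → ℕ → V) :=
  measurable_pi_lambda _ fun k => measurable_pi_apply (n + k)

theorem measurable_initialSegment (n : ℕ) :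
    Measurable (initialSegment n : (ℕ → V) → Fin (n + 1) → V) :=
  measurable_pi_lambda _ fun i => measurable_pi_apply (i : ℕ)

open Classical in
/-- The family `P` consists of the laws of the Markov chain with transition probabilities `p`. -/
def IsMarkovFamily (p : V → V → ENNReal) (P : V → Measure (ℕ → V)) : Prop :=
  ∀ (x : V) (n : ℕ) (c : ℕ → V), P x (cylinderUpTo n c) =
    (if c 0 = x then 1 else 0) * ∏ i ∈ Finset.range n, p (c i) (c (i + 1))

namespace IsMarkovFamily

variable {p : V → V → ENNReal} {P : V → Measure (ℕ → V)}

theorem measure_start (hP : IsMarkovFamily p P) (x : V) : P x {w | w 0 = x} = 1 := by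
  simpa [cylinderUpTo] using hP x 0 fun _ => x

theorem measure_cylinder_inter_shift_cylinder (hP : IsMarkovFamily p P) (x : V) (n m : ℕ)
    (c d : ℕ → V) :
    P x (cylinderUpTo n c ∩ shiftPath n ⁻¹' cylinderUpTo m d) =
      P x (cylinderUpTo n c) * P (c n) (cylinderUpTo m d) := by
  by_cases h : d 0 = c n
  · set e : ℕ → V := fun i => if i ≤ n then c i else d (i - n) with he
    have e_le : ∀ i ≤ n, e i = c i := fun i hi => if_pos hi
    have e_add : ∀ i, e (n + i) = d i := by
      intro i
      rcases Nat.eq_zero_or_pos i with rfl | hi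
      · simp [he, h]
      · simp [he, hi.ne']
    have h1 : cylinderUpTo n c ∩ shiftPath n ⁻¹' cylinderUpTo m d = cylinderUpTo (n + m) e := by
      ext w
      constructor
      · rintro ⟨h1, h2⟩ i hi
        rcases le_total i n with hin | hin
        · rw [e_le i hin, h1 i hin]
        · obtain ⟨k, rfl⟩ := Nat.exists_eq_add_of_le hin
          rw [e_add]
          exact h2 k (by omega)
      · intro hw
        refine ⟨fun i hi => ?_, fun i hi => ?_⟩
        · rw [hw i (by omega), e_le i hi]
        · exact (hw (n + i) (by omega)).trans (e_add i)
    rw [h1, hP, hP, hP, if_pos h, one_mul, Finset.prod_range_add, e_le 0 (Nat.zero_le _), mul_assoc]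
    congr 2
    · refine Finset.prod_congr rfl fun i hi => ?_
      rw [Finset.mem_range] at hi
      rw [e_le i hi.le, e_le (i + 1) hi]
    · refine Finset.prod_congr rfl fun i _ => ?_
      rw [add_assoc, e_add, e_add]
  · have h1 : cylinderUpTo n c ∩ shiftPath n ⁻¹' cylinderUpTo m d = ∅ := by
      refine Set.eq_empty_of_forall_notMem ?_
      rintro w ⟨h1, h2⟩
      exact h ((h2 0 (Nat.zero_le _)).symm.trans (h1 n le_rfl))
    rw [h1, hP (c n), if_neg h]
    simp

theorem measure_coord_zero (hP : IsMarkovFamily p P) {x y : V} (hxy : x ≠ y) :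
    P x {w | w 0 = y} = 0 := by
  simpa [cylinderUpTo, hxy.symm] using hP x 0 fun _ => y

end IsMarkovFamily

variable [Countable V] [DiscreteMeasurableSpace V]

theorem measurableSet_initialSegment_preimage (n : ℕ) (s : Set (Fin (n + 1) → V)) :
    MeasurableSet (initialSegment n ⁻¹' s) :=
  measurable_initialSegment n s.to_countable.measurableSet

theorem measurableSet_cylinderUpTo (n : ℕ) (c : ℕ → V) : MeasurableSet (cylinderUpTo n c) :=
  preimage_initialSegment_singleton n c ▸ measurableSet_initialSegment_preimage n _

theorem measurableSet_coord (n : ℕ) (s : Set V) : MeasurableSet {w : ℕ → V | w n ∈ s} :=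
  measurable_pi_apply n s.to_countable.measurableSet

theorem measurableSet_coord_eq (n : ℕ) (y : V) : MeasurableSet {w : ℕ → V | w n = y} :=
  measurableSet_coord n {y}

theorem measurableSet_hits (K : Set V) : MeasurableSet (hits K) :=
  hits_eq_iUnion K ▸ MeasurableSet.iUnion fun n => measurableSet_coord n K

theorem measurableSet_noReturn (K : Set V) : MeasurableSet (noReturn K) := by
  have h : noReturn K = ⋂ n ≥ 1, {w : ℕ → V | w n ∈ Kᶜ} := by
    ext w
    simp [noReturn]
  rw [h]
  exact MeasurableSet.iInter fun n => MeasurableSet.iInter fun _ => measurableSet_coord n _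

theorem generateFrom_cylinderUpTo :
    (inferInstance : MeasurableSpace (ℕ → V)) =
      MeasurableSpace.generateFrom {A : Set (ℕ → V) | ∃ n c, A = cylinderUpTo n c} := by
  apply le_antisymm
  · refine iSup_le fun i => ?_
    rintro _ ⟨s, -, rfl⟩
    have h : (fun w : ℕ → V => w i) ⁻¹' s =
        ⋃ c ∈ {c : Fin (i + 1) → V | c (Fin.last i) ∈ s}, initialSegment i ⁻¹' {c} := by
      ext w
      simp [initialSegment]
    rw [h]
    refine MeasurableSet.biUnion (Set.to_countable _) fun c _ => ?_
    obtain ⟨c, rfl⟩ := initialSegment_surjective i c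
    exact MeasurableSpace.measurableSet_generateFrom
      ⟨i, c, preimage_initialSegment_singleton i c⟩
  · refine MeasurableSpace.generateFrom_le ?_
    rintro _ ⟨n, c, rfl⟩
    exact measurableSet_cylinderUpTo n c

theorem measure_eq_tsum_coord (μ : Measure (ℕ → V)) (n : ℕ) {A : Set (ℕ → V)} :
    μ A = ∑' z, μ ({w | w n = z} ∩ A) := by
  have h := tsum_measure_preimage_singleton (μ := μ.restrict A) (f := fun w => w n)
    (Set.to_countable (Set.univ : Set V)) fun y _ => measurableSet_coord_eq n y
  rw [Set.preimage_univ, Measure.restrict_apply_univ,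
    tsum_univ (fun z => (μ.restrict A) ((fun w : ℕ → V => w n) ⁻¹' {z}))] at h
  rw [← h]
  exact tsum_congr fun z => Measure.restrict_apply (measurableSet_coord_eq n z)

namespace IsMarkovFamily

variable {p : V → V → ENNReal} {P : V → Measure (ℕ → V)} [∀ x, IsProbabilityMeasure (P x)]

theorem measure_cylinder_inter_shift (hP : IsMarkovFamily p P) (x : V) (n : ℕ) (c : ℕ → V)
    {A : Set (ℕ → V)} (hA : MeasurableSet A) :
    P x (cylinderUpTo n c ∩ shiftPath n ⁻¹' A) = P x (cylinderUpTo n c) * P (c n) A := by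
  have h : ((P x).restrict (cylinderUpTo n c)).map (shiftPath n) =
      P x (cylinderUpTo n c) • P (c n) := by
    refine ext_of_generate_finite _ generateFrom_cylinderUpTo isPiSystem_cylinderUpTo ?_ ?_
    · rintro _ ⟨m, d, rfl⟩
      rw [Measure.map_apply (measurable_shiftPath n) (measurableSet_cylinderUpTo m d),
        Measure.restrict_apply (measurable_shiftPath n (measurableSet_cylinderUpTo m d)),
        Set.inter_comm, hP.measure_cylinder_inter_shift_cylinder]
      rfl
    · rw [Measure.map_apply (measurable_shiftPath n) MeasurableSet.univ]
      simp
  have h' := congrArg (fun μ => μ A) h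
  simp only [Measure.map_apply (measurable_shiftPath n) hA,
    Measure.restrict_apply (measurable_shiftPath n hA)] at h'
  rw [Set.inter_comm, h']
  rfl

/-- The Markov property at time `n`, for events depending on the first `n + 1` positions. -/
theorem measure_initialSegment_inter_shift (hP : IsMarkovFamily p P) (x : V) (n : ℕ)
    (s : Set (Fin (n + 1) → V)) {A : Set (ℕ → V)} (hA : MeasurableSet A) :
    P x (initialSegment n ⁻¹' s ∩ shiftPath n ⁻¹' A) =
      ∑' c : s, P x (initialSegment n ⁻¹' {c.1}) * P (c.1 (Fin.last n)) A := by
  rw [← Measure.restrict_apply (measurableSet_initialSegment_preimage n s),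
    ← tsum_measure_preimage_singleton s.to_countable
      fun c _ => measurableSet_initialSegment_preimage n {c}]
  refine tsum_congr fun c => ?_
  obtain ⟨c, hc⟩ := c
  obtain ⟨c, rfl⟩ := initialSegment_surjective n c
  rw [Measure.restrict_apply (measurableSet_initialSegment_preimage n _),
    preimage_initialSegment_singleton, hP.measure_cylinder_inter_shift x n c hA]
  simp [initialSegment]

/-- The Markov property at a fixed time. -/
theorem measure_coord_inter_shift (hP : IsMarkovFamily p P) (x y : V) (n : ℕ)
    {A : Set (ℕ → V)} (hA : MeasurableSet A) :
    P x ({w | w n = y} ∩ shiftPath n ⁻¹' A) = P x {w | w n = y} * P y A := by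
  have h : {w : ℕ → V | w n = y} =
      initialSegment n ⁻¹' {c : Fin (n + 1) → V | c (Fin.last n) = y} := by
    ext w
    simp [initialSegment]
  rw [h, hP.measure_initialSegment_inter_shift x n _ hA,
    ← tsum_measure_preimage_singleton (Set.to_countable _)
      fun c _ => measurableSet_initialSegment_preimage n {c}, ← ENNReal.tsum_mul_right]
  refine tsum_congr fun c => ?_
  rw [show c.1 (Fin.last n) = y from c.2]

theorem mul_measure_le_measure_inter_shift (hP : IsMarkovFamily p P) (x : V) (n : ℕ)
    (s : Set (Fin (n + 1) → V)) {A : Set (ℕ → V)} (hA : MeasurableSet A) (r : ENNReal)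
    (hr : ∀ c ∈ s, r ≤ P (c (Fin.last n)) A) :
    r * P x (initialSegment n ⁻¹' s) ≤ P x (initialSegment n ⁻¹' s ∩ shiftPath n ⁻¹' A) := by
  rw [hP.measure_initialSegment_inter_shift x n _ hA,
    ← tsum_measure_preimage_singleton s.to_countable
      fun c _ => measurableSet_initialSegment_preimage n {c}, ← ENNReal.tsum_mul_left]
  refine ENNReal.tsum_le_tsum fun c => ?_
  rw [mul_comm]
  gcongr
  exact hr c c.2

theorem measure_coord_one (hP : IsMarkovFamily p P) (x y : V) :
    P x {w | w 1 = y} = p x y := by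
  have h := hP x 1 fun i => if i = 0 then x else y
  have hs : cylinderUpTo 1 (fun i => if i = 0 then x else y) =
      {w | w 1 = y} ∩ {w : ℕ → V | w 0 = x} := by
    ext w
    simp only [cylinderUpTo, Set.mem_ofPred_eq, Set.mem_inter_iff]
    constructor
    · intro h
      exact ⟨by simpa using h 1 le_rfl, by simpa using h 0 zero_le_one⟩
    · rintro ⟨h1, h0⟩ i hi
      interval_cases i <;> simpa
  rw [hs, measure_inter_conull ((prob_compl_eq_zero_iff (measurableSet_coord_eq 0 x)).2
    (hP.measure_start x))] at h
  simpa using h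

theorem measure_coord_succ (hP : IsMarkovFamily p P) (x y : V) (n : ℕ) :
    P x {w | w (n + 1) = y} = ∑' z, P x {w | w n = z} * p z y := by
  rw [measure_eq_tsum_coord (P x) n]
  refine tsum_congr fun z => ?_
  rw [← hP.measure_coord_one z y, ← hP.measure_coord_inter_shift x z n (measurableSet_coord_eq 1 y)]
  rfl

theorem measure_coord_succ' (hP : IsMarkovFamily p P) (x y : V) (n : ℕ) :
    P x {w | w (n + 1) = y} = ∑' z, p x z * P z {w | w n = y} := by
  rw [measure_eq_tsum_coord (P x) 1]
  refine tsum_congr fun z => ?_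
  rw [← hP.measure_coord_one x z, ← hP.measure_coord_inter_shift x z 1 (measurableSet_coord_eq n y),
    add_comm n 1]
  rfl

/-- A reversible one-step kernel has reversible `n`-step kernels. -/
theorem reversible (hP : IsMarkovFamily p P) {m : V → ENNReal}
    (hm : ∀ x y, m x * p x y = m y * p y x) (n : ℕ) (x y : V) :
    m x * P x {w | w n = y} = m y * P y {w | w n = x} := by
  induction n generalizing x y with
  | zero =>
    by_cases h : x = y
    · rw [h]
    · rw [hP.measure_coord_zero h, hP.measure_coord_zero (Ne.symm h), mul_zero, mul_zero]
  | succ n ih =>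
    rw [hP.measure_coord_succ' x y, hP.measure_coord_succ y x, ← ENNReal.tsum_mul_left,
      ← ENNReal.tsum_mul_left]
    refine tsum_congr fun z => ?_
    rw [← mul_assoc, hm x z, mul_right_comm, ih z y]
    ring

/-- Maximal inequality: the chain visits the set where `A` has probability at least `r` after
time `N` with probability at most `r⁻¹` times that of `shiftPath m w ∈ A` for some `m ≥ N`. -/
theorem mul_measure_exists_ge_le (hP : IsMarkovFamily p P) (x : V) (N : ℕ) {A : Set (ℕ → V)}
    (hA : MeasurableSet A) (r : ENNReal) :
    r * P x {w | ∃ m ≥ N, r ≤ P (w m) A} ≤ P x {w | ∃ m ≥ N, shiftPath m w ∈ A} := by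
  set S : Set V := {v | r ≤ P v A} with hS
  let s : (m : ℕ) → Set (Fin (m + 1) → V) := fun m =>
    {c | N ≤ m ∧ c (Fin.last m) ∈ S ∧ ∀ i : Fin (m + 1), N ≤ i → (i : ℕ) < m → c i ∉ S}
  have hmem : ∀ m w, w ∈ initialSegment m ⁻¹' s m ↔
      N ≤ m ∧ w m ∈ S ∧ ∀ i, N ≤ i → i < m → w i ∉ S := by
    intro m w
    simp only [s, initialSegment, Set.mem_preimage, Set.mem_ofPred_eq, Fin.val_last, Fin.forall_iff]
    refine and_congr_right fun _ => and_congr_right fun _ => ?_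
    exact ⟨fun h i h1 h2 => h i (by omega) h1 h2, fun h i _ h1 h2 => h i h1 h2⟩
  have hdisj : Pairwise (Function.onFun Disjoint fun m => initialSegment m ⁻¹' s m) := by
    intro i j hij
    refine Set.disjoint_left.2 fun w hi hj => ?_
    rw [hmem] at hi hj
    rcases lt_or_gt_of_ne hij with h | h
    · exact hj.2.2 i hi.1 h hi.2.1
    · exact hi.2.2 j hj.1 h hj.2.1
  have hU : {w : ℕ → V | ∃ m ≥ N, r ≤ P (w m) A} = ⋃ m, initialSegment m ⁻¹' s m := by
    classical
    ext w
    simp only [Set.mem_iUnion, hmem]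
    constructor
    · intro h
      refine ⟨Nat.find h, (Nat.find_spec h).1, (Nat.find_spec h).2, fun i h1 h2 h3 => ?_⟩
      exact Nat.find_min h h2 ⟨h1, h3⟩
    · rintro ⟨m, h1, h2, -⟩
      exact ⟨m, h1, h2⟩
  rw [hU, measure_iUnion hdisj fun m => measurableSet_initialSegment_preimage m _,
    ← ENNReal.tsum_mul_left]
  calc ∑' m, r * P x (initialSegment m ⁻¹' s m)
      ≤ ∑' m, P x (initialSegment m ⁻¹' s m ∩ shiftPath m ⁻¹' A) :=
        ENNReal.tsum_le_tsum fun m =>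
          hP.mul_measure_le_measure_inter_shift x m _ hA r fun c hc => hc.2.1
    _ = P x (⋃ m, initialSegment m ⁻¹' s m ∩ shiftPath m ⁻¹' A) :=
        (measure_iUnion (fun i j hij => (hdisj hij).mono Set.inter_subset_left
          Set.inter_subset_left) fun m => (measurableSet_initialSegment_preimage m _).inter
            (measurable_shiftPath m hA)).symm
    _ ≤ _ := by
        refine measure_mono (Set.iUnion_subset fun m w hw => ?_)
        exact ⟨m, ((hmem m w).1 hw.1).1, hw.2⟩

/-- Last-exit decomposition, together with reversibility and a union bound. -/
theorem sum_measure_noReturn_mul_hits_le (hP : IsMarkovFamily p P) {m : V → ENNReal}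
    (hm : ∀ x y, m x * p x y = m y * p y x) (x : V) (K T : Finset V) (hTK : T ⊆ K) :
    ∑ y ∈ T, m y * P y (noReturn (K : Set V)) * P y (hits {x}) ≤
      m x * P x (lastVisitIn (K : Set V) (T : Set V)) := by
  let D : V → ℕ → Set (ℕ → V) := fun y k =>
    {w | w k = y} ∩ shiftPath k ⁻¹' noReturn (K : Set V)
  have hDm : ∀ y k, MeasurableSet (D y k) := fun y k =>
    (measurableSet_coord_eq k y).inter (measurable_shiftPath k (measurableSet_noReturn _))
  have hnr : ∀ {y k w}, w ∈ D y k → ∀ j > k, w j ∉ K := by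
    rintro y k w ⟨-, h⟩ j hj
    obtain ⟨i, rfl⟩ := Nat.exists_eq_add_of_le hj.le
    exact h i (by omega)
  have huniq : ∀ {y z i j w}, y ∈ T → z ∈ T → w ∈ D y i → w ∈ D z j → i = j := by
    intro y z i j w hy hz h1 h2
    by_contra hij
    rcases lt_or_gt_of_ne hij with h | h
    · exact hnr h1 j h (h2.1.symm ▸ hTK hz)
    · exact hnr h2 i h (h1.1.symm ▸ hTK hy)
  have hy : ∀ y ∈ T, m y * P y (noReturn (K : Set V)) * P y (hits {x}) ≤
      m x * P x (⋃ k, D y k) := by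
    intro y hy
    calc m y * P y (noReturn (K : Set V)) * P y (hits {x})
        ≤ m y * P y (noReturn (K : Set V)) * ∑' k, P y {w | w k = x} := by
          gcongr
          rw [hits_eq_iUnion]
          exact measure_iUnion_le _
      _ = ∑' k, m x * P x (D y k) := by
          rw [← ENNReal.tsum_mul_left]
          refine tsum_congr fun k => ?_
          rw [hP.measure_coord_inter_shift x y k (measurableSet_noReturn _), ← mul_assoc,
            hP.reversible hm k x y]
          ring
      _ = m x * P x (⋃ k, D y k) := by
          rw [ENNReal.tsum_mul_left, measure_iUnion _ (hDm y)]
          exact fun i j hij => Set.disjoint_left.2 fun w h1 h2 => hij (huniq hy hy h1 h2)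
  refine (Finset.sum_le_sum hy).trans ?_
  rw [← Finset.mul_sum, ← measure_biUnion_finset _ fun y _ => MeasurableSet.iUnion (hDm y)]
  · gcongr
    refine Set.iUnion₂_subset fun y hy => Set.iUnion_subset fun k w hw => ?_
    have hwk : w k = y := hw.1
    exact ⟨k, hwk ▸ hTK hy, hwk ▸ hy, hnr hw⟩
  · intro y hy z hz hyz
    refine Set.disjoint_left.2 fun w h1 h2 => hyz ?_
    obtain ⟨i, hi⟩ := Set.mem_iUnion.1 h1
    obtain ⟨j, hj⟩ := Set.mem_iUnion.1 h2
    obtain rfl := huniq hy hz hi hj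
    exact hi.1.symm.trans hj.1

theorem tendsto_measure_exists_ge_hits {x y : V} (htrans : ∀ᵐ w ∂ P x, {n : ℕ | w n = y}.Finite) :
    Tendsto (fun N => P x {w | ∃ m ≥ N, shiftPath m w ∈ hits {y}}) atTop (nhds 0) := by
  have hset : ∀ N, {w : ℕ → V | ∃ m ≥ N, shiftPath m w ∈ hits {y}} =
      ⋃ m ≥ N, {w | w m ∈ ({y} : Set V)} := by
    intro N
    ext w
    simp only [hits, shiftPath, Set.mem_ofPred_eq, Set.mem_iUnion, exists_prop]
    constructor
    · rintro ⟨m, hm, n, h⟩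
      exact ⟨m + n, by omega, h⟩
    · rintro ⟨m, hm, h⟩
      exact ⟨m, hm, 0, h⟩
  simp only [hset]
  have hinter : P x (⋂ N : ℕ, ⋃ m ≥ N, {w | w m ∈ ({y} : Set V)}) = 0 := by
    refine measure_mono_null ?_ htrans
    intro w hw hfin
    obtain ⟨B, hB⟩ := hfin.bddAbove
    obtain ⟨m, hm, hwm⟩ := Set.mem_iUnion₂.1 (Set.mem_iInter.1 hw (B + 1))
    have : m ≤ B := hB hwm
    omega
  rw [← hinter]
  refine tendsto_measure_iInter_atTop (fun N => ?_) ?_ ⟨0, measure_ne_top _ _⟩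
  · exact (MeasurableSet.iUnion fun m => MeasurableSet.iUnion fun _ =>
      measurableSet_coord m _).nullMeasurableSet
  · intro N M h
    exact Set.biUnion_subset_biUnion_left fun m (hm : m ≥ M) => h.trans hm

theorem tendsto_measure_notMem_exhaustion (x : V) (N : ℕ) {L : ℕ → Finset V} (hL : Monotone L)
    (hex : ∀ v, ∃ n, v ∈ L n) :
    Tendsto (fun n => P x {w | w N ∉ L n}) atTop (nhds 0) := by
  have hinter : P x (⋂ n, {w | w N ∉ L n}) = 0 := by
    convert measure_empty (μ := P x)
    refine Set.eq_empty_of_forall_notMem fun w hw => ?_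
    obtain ⟨n, hn⟩ := hex (w N)
    exact Set.mem_iInter.1 hw n hn
  rw [← hinter]
  refine tendsto_measure_iInter_atTop (fun n => ?_) ?_ ⟨0, measure_ne_top _ _⟩
  · exact (measurableSet_coord N (L n : Set V)ᶜ).nullMeasurableSet
  · exact fun n k h w hw hn => hw (hL h hn)

/-- In a transient chain, the last point visited in a large finite set is unlikely to have a
hitting probability of `x` bounded below. -/
theorem tendsto_measure_lastVisitIn (hP : IsMarkovFamily p P) {x : V}
    (htrans : ∀ᵐ w ∂ P x, {n : ℕ | w n = x}.Finite) {r : ENNReal} (hr : r ≠ 0) (hr' : r ≠ ⊤)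
    {L : ℕ → Finset V} (hL : Monotone L) (hex : ∀ v, ∃ n, v ∈ L n) :
    Tendsto (fun n => P x (lastVisitIn (L n : Set V) {v | r ≤ P v (hits {x})})) atTop
      (nhds 0) := by
  rw [ENNReal.tendsto_atTop_zero]
  intro δ hδ
  have hδ2 : 0 < δ / 2 := ENNReal.half_pos hδ.ne'
  obtain ⟨N, hN⟩ := ENNReal.tendsto_atTop_zero.1 (tendsto_measure_exists_ge_hits htrans)
    (r * (δ / 2)) (ENNReal.mul_pos hr hδ2.ne')
  obtain ⟨M, hM⟩ := ENNReal.tendsto_atTop_zero.1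
    (tendsto_measure_notMem_exhaustion (P := P) x N hL hex) (δ / 2) hδ2
  refine ⟨M, fun n hn => ?_⟩
  have hlate : P x {w | ∃ m ≥ N, r ≤ P (w m) (hits {x})} ≤ δ / 2 :=
    (ENNReal.mul_le_mul_iff_right hr hr').1
      ((hP.mul_measure_exists_ge_le x N (measurableSet_hits {x}) r).trans (hN N le_rfl))
  calc P x (lastVisitIn (L n : Set V) {v | r ≤ P v (hits {x})})
      ≤ P x ({w | ∃ m ≥ N, r ≤ P (w m) (hits {x})} ∪ {w | w N ∉ L n}) := by
        refine measure_mono ?_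
        rintro w ⟨k, hkL, hkr, hk⟩
        rcases le_or_gt N k with h | h
        · exact Or.inl ⟨k, h, hkr⟩
        · exact Or.inr (hk N h)
    _ ≤ δ / 2 + δ / 2 := (measure_union_le _ _).trans (add_le_add hlate (hM n hn))
    _ = δ := ENNReal.add_halves δ

end IsMarkovFamily

end MarkovChain

section Conductances

variable {V : Type*} (G : SimpleGraph V) [G.LocallyFinite] {a : V → V → ℝ}

theorem aTot_nonneg (hpos : ∀ x y, G.Adj x y → 0 < a x y) (x : V) : 0 ≤ aTot G a x :=
  Finset.sum_nonneg fun z hz => (hpos x z ((G.mem_neighborFinset x z).1 hz)).le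

theorem aTot_pos_of_adj (hpos : ∀ x y, G.Adj x y → 0 < a x y) {x y : V} (h : G.Adj x y) :
    0 < aTot G a x :=
  Finset.sum_pos (fun z hz => hpos x z ((G.mem_neighborFinset x z).1 hz))
    ⟨y, (G.mem_neighborFinset x y).2 h⟩

theorem aTot_mul_step (hpos : ∀ x y, G.Adj x y → 0 < a x y) (hsymm : ∀ x y, a x y = a y x)
    (x y : V) : aTot G a x * step G a x y = aTot G a y * step G a y x := by
  by_cases h : G.Adj x y
  · rw [step, step, if_pos h, if_pos h.symm, mul_div_cancel₀ _ (aTot_pos_of_adj G hpos h).ne',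
      mul_div_cancel₀ _ (aTot_pos_of_adj G hpos h.symm).ne', hsymm]
  · rw [step, step, if_neg h, if_neg fun h' => h h'.symm, mul_zero, mul_zero]

end Conductances

open ProbabilityTheory in
open Classical in
/-- For every vertex `x` and every `ε > 0`,
`Σ_{x'∈L} e_L(x') · max(P_{x'}[τ_{{x}} < ∞] − ε, 0) → 0` along every exhaustion `(L_n)` of `V`. -/
theorem equil_hitting_diluted
    {V : Type*} [Countable V] [MeasurableSpace V] [DiscreteMeasurableSpace V]
    (G : SimpleGraph V) [G.LocallyFinite] (hconn : G.Connected)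
    (a : V → V → ℝ)
    (hsymm : ∀ x y, a x y = a y x)
    (hpos : ∀ x y, G.Adj x y → 0 < a x y)
    (P : V → Measure (ℕ → V)) (hprob : ∀ x, IsProbabilityMeasure (P x))
    (hP : ∀ (x : V) (n : ℕ) (c : ℕ → V),
      P x {w | ∀ i ≤ n, w i = c i} =
        (if c 0 = x then 1 else 0) *
          ∏ i ∈ Finset.range n, ENNReal.ofReal (step G a (c i) (c (i + 1))))
    (htrans : ∀ x y : V, ∀ᵐ w ∂ P x, {n : ℕ | w n = y}.Finite)
    (x : V) (ε : ℝ) (hε : 0 < ε)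
    (L : ℕ → Finset V) (hLmono : Monotone L) (hLexh : ∀ v : V, ∃ n, v ∈ L n) :
    Tendsto (fun n =>
        ∑ x' ∈ L n, equil G a P (L n) x' *
          max (((P x') (hits ({x} : Set V))).toReal - ε) 0)
      atTop (nhds 0) := by
  classical
  have hM : IsMarkovFamily (fun x y => ENNReal.ofReal (step G a x y)) P := by
    intro x n c
    convert hP x n c using 1
    rfl
  set m : V → ENNReal := fun y => ENNReal.ofReal (aTot G a y) with hm_def
  have hm : ∀ y z, m y * ENNReal.ofReal (step G a y z) = m z * ENNReal.ofReal (step G a z y) := by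
    intro y z
    rw [hm_def, ← ENNReal.ofReal_mul (aTot_nonneg G hpos y),
      ← ENNReal.ofReal_mul (aTot_nonneg G hpos z), aTot_mul_step G hpos hsymm]
  have hlim := ENNReal.Tendsto.const_mul (a := m x)
    (hM.tendsto_measure_lastVisitIn (htrans x x) (ENNReal.ofReal_pos.2 hε).ne'
      ENNReal.ofReal_ne_top hLmono hLexh) (Or.inr ENNReal.ofReal_ne_top)
  rw [mul_zero] at hlim
  replace hlim := (ENNReal.tendsto_toReal ENNReal.zero_ne_top).comp hlim
  rw [ENNReal.toReal_zero] at hlim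
  have hequil : ∀ n y, 0 ≤ equil G a P (L n) y := by
    intro n y
    unfold equil
    split_ifs
    · exact mul_nonneg (aTot_nonneg G hpos y) ENNReal.toReal_nonneg
    · exact le_rfl
  refine squeeze_zero (fun n => Finset.sum_nonneg fun y _ =>
    mul_nonneg (hequil n y) (le_max_right _ _)) (fun n => ?_) hlim
  set T := (L n).filter fun y => ENNReal.ofReal ε ≤ P y (hits {x}) with hT
  have hsum := hM.sum_measure_noReturn_mul_hits_le hm x (L n) T (Finset.filter_subset _ _)
  calc ∑ y ∈ L n, equil G a P (L n) y * max ((P y (hits {x})).toReal - ε) 0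
      ≤ ∑ y ∈ T, (m y * P y (noReturn (L n : Set V)) * P y (hits {x})).toReal := by
        rw [hT, Finset.sum_filter]
        refine Finset.sum_le_sum fun y hy => ?_
        split_ifs with h
        · rw [ENNReal.toReal_mul, ENNReal.toReal_mul, hm_def,
            ENNReal.toReal_ofReal (aTot_nonneg G hpos y), equil, if_pos hy]
          refine mul_le_mul_of_nonneg_left (max_le (by linarith) ENNReal.toReal_nonneg)
            (mul_nonneg (aTot_nonneg G hpos y) ENNReal.toReal_nonneg)
        · have hle : (P y (hits {x})).toReal ≤ ε :=
            ENNReal.toReal_le_of_le_ofReal hε.le (not_le.1 h).le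
          rw [max_eq_right (by linarith), mul_zero]
    _ = (∑ y ∈ T, m y * P y (noReturn (L n : Set V)) * P y (hits {x})).toReal :=
        (ENNReal.toReal_sum fun y _ => ENNReal.mul_ne_top
          (ENNReal.mul_ne_top ENNReal.ofReal_ne_top (measure_ne_top _ _))
            (measure_ne_top _ _)).symm
    _ ≤ (m x * P x (lastVisitIn (L n : Set V) {v | ENNReal.ofReal ε ≤ P v (hits {x})})).toReal := by
        refine ENNReal.toReal_mono (ENNReal.mul_ne_top ENNReal.ofReal_ne_top (measure_ne_top _ _))
          (hsum.trans ?_)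
        gcongr
        rintro w ⟨k, h1, h2, h3⟩
        exact ⟨k, h1, (Finset.mem_filter.1 h2).2, h3⟩
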